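/- Let d, k, L be positive integers and let x be a real number with 0 ≤ x ≤ k and k − x ≤ d. Let z be a point of the d-dimensional Hamming cube, and let G : Fin L → (Fin k → Fin d) be any family of L hash functions each of which has support size at least k − x. Let s ≤ d be a natural number and let q be drawn uniformly at random from the points at Hamming distance exactly s from z. Then the expected size of Coll(q, z) is at most L·(1 − (k−x)/d)^s. -/

import Mathlib

/-- The points of a Hamming sphere of radius `s` around `z` that agree with `z` on `T` are
counted by the `s`-element subsets of the complement of `T`. -/
theorem card_hammingSphere_agree {ι : Type*} [Fintype ι] [DecidableEq ι] (z : ι → Bool)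
    (T : Finset ι) (s : ℕ) :
    (Finset.univ.filter (fun q : ι → Bool => hammingDist q z = s ∧ ∀ i ∈ T, q i = z i)).card
      = (Fintype.card ι - T.card).choose s := by
  rw [← Finset.card_compl, ← Finset.card_powersetCard]
  refine Finset.card_nbij' (fun q => Finset.univ.filter (fun i => q i ≠ z i))
    (fun S i => if i ∈ S then !z i else z i) ?_ ?_ ?_ ?_
  · intro q hq
    simp only [Finset.coe_filter, Finset.mem_univ, true_and, Set.mem_ofPred_eq] at hq
    simp only [Finset.mem_coe, Finset.mem_powersetCard]
    refine ⟨fun i hi => ?_, hq.1⟩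
    simp only [Finset.mem_filter, Finset.mem_univ, true_and] at hi
    exact Finset.mem_compl.2 fun hT => hi (hq.2 i hT)
  · intro S hS
    simp only [Finset.mem_coe, Finset.mem_powersetCard] at hS
    simp only [Finset.coe_filter, Finset.mem_univ, true_and, Set.mem_ofPred_eq]
    refine ⟨?_, fun i hi => if_neg fun hiS => Finset.mem_compl.1 (hS.1 hiS) hi⟩
    rw [← hS.2, hammingDist]
    congr 1
    ext i
    by_cases hi : i ∈ S <;> simp [hi]
  · intro q _
    funext i
    cases hq : q i <;> cases hz : z i <;> simp [hq, hz]
  · intro S _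
    ext i
    by_cases hi : i ∈ S <;> simp [hi]

theorem card_hammingSphere {ι : Type*} [Fintype ι] [DecidableEq ι] (z : ι → Bool) (s : ℕ) :
    (Finset.univ.filter (fun q : ι → Bool => hammingDist q z = s)).card
      = (Fintype.card ι).choose s := by
  simpa using card_hammingSphere_agree z ∅ s

theorem Nat.choose_mul_pow_le_choose_mul_pow {m d : ℕ} (hmd : m ≤ d) (s : ℕ) :
    m.choose s * d ^ s ≤ d.choose s * m ^ s := by
  induction s with
  | zero => simp
  | succ s ih =>
    have hstep : (m - s) * d ≤ (d - s) * m := by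
      rw [Nat.sub_mul, Nat.sub_mul, Nat.mul_comm m d]
      exact Nat.sub_le_sub_left (Nat.mul_le_mul_left s hmd) _
    refine Nat.le_of_mul_le_mul_right (c := s + 1) ?_ s.succ_pos
    calc m.choose (s + 1) * d ^ (s + 1) * (s + 1)
        = (m.choose (s + 1) * (s + 1)) * d ^ (s + 1) := by ring
      _ = (m.choose s * d ^ s) * ((m - s) * d) := by
        rw [Nat.choose_succ_right_eq]; ring
      _ ≤ (d.choose s * m ^ s) * ((d - s) * m) := Nat.mul_le_mul ih hstep
      _ = (d.choose (s + 1) * (s + 1)) * m ^ (s + 1) := by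
        rw [Nat.choose_succ_right_eq]; ring
      _ = d.choose (s + 1) * m ^ (s + 1) * (s + 1) := by ring

/-- If every hash function of the family `G : Fin L → (Fin k → Fin d)` has support size at
least `k − x`, and `q` is drawn uniformly at random from the Hamming sphere of radius `s`
around `z`, then the expected size of `Coll(q, z)` is at most `L·(1 − (k−x)/d)^s`. -/
theorem expected_collisions_generic (d k L : ℕ) (hd : 0 < d) (hk : 0 < k) (hL : 0 < L)
    (x : ℝ) (hx0 : 0 ≤ x) (hxk : x ≤ k) (hkxd : (k : ℝ) - x ≤ d)
    (z : Fin d → Bool)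
    (G : Fin L → Fin k → Fin d)
    (hG : ∀ j : Fin L, (k : ℝ) - x ≤ ((Finset.image (G j) Finset.univ).card : ℝ))
    (s : ℕ) (hs : s ≤ d) :
    (∑ q ∈ Finset.univ.filter (fun q : Fin d → Bool => hammingDist q z = s),
        ((Finset.univ.filter (fun j : Fin L =>
            ∀ m : Fin k, q (G j m) = z (G j m))).card : ℝ))
      / ((Finset.univ.filter (fun q : Fin d → Bool => hammingDist q z = s)).card : ℝ)
      ≤ (L : ℝ) * (1 - ((k : ℝ) - x) / d) ^ s := by
  have hd' : (0 : ℝ) < d := Nat.cast_pos.2 hd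
  have hcard := card_hammingSphere z s
  rw [Fintype.card_fin] at hcard
  rw [hcard, div_le_iff₀ (Nat.cast_pos.2 (Nat.choose_pos hs))]
  have hswap := Finset.sum_card_bipartiteAbove_eq_sum_card_bipartiteBelow
    (s := Finset.univ.filter (fun q : Fin d → Bool => hammingDist q z = s))
    (t := (Finset.univ : Finset (Fin L)))
    (fun q j => ∀ m : Fin k, q (G j m) = z (G j m))
  simp only [Finset.bipartiteAbove, Finset.bipartiteBelow, Finset.filter_filter] at hswap
  rw [← Nat.cast_sum, hswap, Nat.cast_sum, mul_assoc]
  calc _ ≤ ∑ _j : Fin L, (1 - ((k : ℝ) - x) / d) ^ s * (d.choose s : ℝ) :=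
        Finset.sum_le_sum fun j _ => ?_
    _ = _ := by simp
  have hcount := card_hammingSphere_agree z (Finset.image (G j) Finset.univ) s
  simp only [Finset.forall_mem_image, Finset.mem_univ, forall_const,
    Fintype.card_fin] at hcount
  rw [hcount]
  have hGj := hG j
  have hTd : (Finset.image (G j) Finset.univ).card ≤ d := by
    simpa using Finset.card_le_univ (Finset.image (G j) Finset.univ)
  generalize (Finset.image (G j) Finset.univ).card = t at hGj hTd
  have hchoose : ((d - t).choose s : ℝ) * (d : ℝ) ^ s ≤ d.choose s * ((d : ℝ) - t) ^ s := by
    rw [← Nat.cast_sub hTd]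
    exact_mod_cast Nat.choose_mul_pow_le_choose_mul_pow (Nat.sub_le d t) s
  have hbase : ((d : ℝ) - t) ^ s ≤ ((d : ℝ) - (k - x)) ^ s :=
    pow_le_pow_left₀ (sub_nonneg.2 (Nat.cast_le.2 hTd)) (by linarith) s
  rw [one_sub_div hd'.ne', div_pow, div_mul_eq_mul_div, le_div_iff₀ (pow_pos hd' s),
    mul_comm (_ ^ s)]
  exact hchoose.trans (mul_le_mul_of_nonneg_left hbase (Nat.cast_nonneg _))
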